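/- arXiv:2409.17305 — 2 statements merged into one kernel-verified Lean document; each statement's English description precedes it below -/
import Mathlib

section
/- Let η, ℓ ∈ ℝ with ℓ ≤ −3/2, η ≠ 0, and 2ℓ+2 not a nonpositive integer (so in particular ℓ is not a half-integer ≤ −3/2). Then φ_{ℓ,η} has countably infinitely many real zeros, all of which are simple, and the positive zeros of φ_{ℓ,η} and φ_{ℓ+1,η} strictly interlace according to the pattern 0 < ρ_{ℓ+1,η,1} < ρ_{ℓ,η,1} < ρ_{ℓ+1,η,2} < ρ_{ℓ,η,2} < ⋯ ; that is, ρ_{ℓ+1,η,k} < ρ_{ℓ,η,k} < ρ_{ℓ+1,η,k+1} for every k ≥ 1. -/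
noncomputable def coulombCoeff (l η : ℝ) : ℕ → ℝ
  | 0 => 1
  | 1 => η / (l + 1)
  | (k + 2) =>
      (2 * η * coulombCoeff l η (k + 1) - coulombCoeff l η k) /
        (((k : ℝ) + 2) * (((k : ℝ) + 2) + 2 * l + 1))

/-- The function φ_{ℓ,η}, real-valued on ℝ. -/
noncomputable def coulombPhi (l η x : ℝ) : ℝ := ∑' k : ℕ, coulombCoeff l η k * x ^ k

/-- `ρ : ℕ → ℝ` enumerates all the positive zeros of `f` in (strictly) increasing order,
`ρ k` being the (k+1)-st positive zero. -/
def IsPosZeroEnum (f : ℝ → ℝ) (ρ : ℕ → ℝ) : Prop :=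
  StrictMono ρ ∧ (∀ k, 0 < ρ k ∧ f (ρ k) = 0) ∧ ∀ x, 0 < x → f x = 0 → ∃ k, ρ k = x

open Real Set Filter Topology

/-- The first-order linear system satisfied by `f = φ_{ℓ,η}` and `g = φ_{ℓ+1,η}`, where
`a = η / (ℓ + 1)` and `m = 2ℓ + 3`. -/
structure IsCoulombPair (a m : ℝ) (f g : ℝ → ℝ) : Prop where
  hasDerivAt_left : ∀ x, HasDerivAt f (a * f x - (1 + a ^ 2) / m * x * g x) x
  hasDerivAt_right : ∀ x, x ≠ 0 → HasDerivAt g ((m * f x - (m + a * x) * g x) / x) x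
  continuous_right : Continuous g
  left_zero : f 0 = 1
  right_zero : g 0 = 1

namespace IsCoulombPair

variable {a m : ℝ} {f g : ℝ → ℝ}

theorem continuous_left (h : IsCoulombPair a m f g) : Continuous f :=
  continuous_iff_continuousAt.2 fun x => (h.hasDerivAt_left x).continuousAt

/-- If both functions vanished at `x₀ > 0`, then `x ^ N * (f x ^ 2 + g x ^ 2)`, which is monotone
on `[0, x₀]` for large `N`, would vanish there, contradicting `f 0 = 1`. -/
theorem right_ne_zero (h : IsCoulombPair a m f g) {x₀ : ℝ} (hx₀ : 0 < x₀)
    (hf : f x₀ = 0) : g x₀ ≠ 0 := by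
  intro hg
  set c := (1 + a ^ 2) / m with hc
  obtain ⟨N, hN⟩ := exists_nat_ge (4 * |a| * x₀ + |c| * x₀ ^ 2 + 3 * |m|)
  have hmono : MonotoneOn (fun x => x ^ (N + 1) * (f x ^ 2 + g x ^ 2)) (Icc 0 x₀) := by
    have hfc := h.continuous_left
    have hgc := h.continuous_right
    refine monotoneOn_of_hasDerivWithinAt_nonneg (convex_Icc _ _)
      (f' := fun x => ((N + 1 : ℕ) : ℝ) * x ^ N * (f x ^ 2 + g x ^ 2)
        + x ^ (N + 1) * (2 * f x * (a * f x - c * x * g x)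
          + 2 * g x * ((m * f x - (m + a * x) * g x) / x)))
      (by fun_prop) ?_ ?_
    · intro x hx
      rw [interior_Icc] at hx
      have h1 := (h.hasDerivAt_left x).pow 2
      have h2 := (h.hasDerivAt_right x hx.1.ne').pow 2
      have h3 := (hasDerivAt_pow (N + 1) x).mul (h1.add h2)
      refine (h3.congr_deriv ?_).hasDerivWithinAt
      simp [hc]
    · intro x hx
      rw [interior_Icc] at hx
      obtain ⟨hx0, hx1⟩ := hx
      have key : ((N + 1 : ℕ) : ℝ) * x ^ N * (f x ^ 2 + g x ^ 2)
        + x ^ (N + 1) * (2 * f x * (a * f x - c * x * g x)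
          + 2 * g x * ((m * f x - (m + a * x) * g x) / x))
        = x ^ N * ((N + 1) * (f x ^ 2 + g x ^ 2) + (2 * (a * x) * f x ^ 2
          - (c * x ^ 2) * (2 * f x * g x) + m * (2 * f x * g x)
          - 2 * (m + a * x) * g x ^ 2)) := by
        push_cast
        field_simp
        ring
      rw [key]
      refine mul_nonneg (by positivity) ?_
      set E := f x ^ 2 + g x ^ 2 with hE
      have hE0 : 0 ≤ E := by positivity
      have hfg : |2 * f x * g x| ≤ E := by
        rw [abs_le]; constructor <;> nlinarith [sq_nonneg (f x + g x), sq_nonneg (f x - g x)]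
      have hax : |a * x| ≤ |a| * x₀ := by
        rw [abs_mul, abs_of_pos hx0]; gcongr
      have hcx : |c * x ^ 2| ≤ |c| * x₀ ^ 2 := by
        rw [abs_mul, abs_of_pos (by positivity : 0 < x ^ 2)]; gcongr
      have e1 : -(|a| * x₀ * E) ≤ (a * x) * f x ^ 2 := by
        have : |a * x * f x ^ 2| ≤ |a| * x₀ * E := by
          rw [abs_mul, abs_of_nonneg (sq_nonneg (f x))]
          gcongr; nlinarith [sq_nonneg (g x)]
        exact (abs_le.1 this).1
      have e2 : (a * x) * g x ^ 2 ≤ |a| * x₀ * E := by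
        have : |a * x * g x ^ 2| ≤ |a| * x₀ * E := by
          rw [abs_mul, abs_of_nonneg (sq_nonneg (g x))]
          gcongr; nlinarith [sq_nonneg (f x)]
        exact (abs_le.1 this).2
      have e3 : (c * x ^ 2) * (2 * f x * g x) ≤ |c| * x₀ ^ 2 * E := by
        have : |(c * x ^ 2) * (2 * f x * g x)| ≤ |c| * x₀ ^ 2 * E := by
          rw [abs_mul]; gcongr
        exact (abs_le.1 this).2
      have e4 : -(|m| * E) ≤ m * (2 * f x * g x) := by
        have : |m * (2 * f x * g x)| ≤ |m| * E := by
          rw [abs_mul]; gcongr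
        exact (abs_le.1 this).1
      have e5 : m * g x ^ 2 ≤ |m| * E := by
        have : |m * g x ^ 2| ≤ |m| * E := by
          rw [abs_mul, abs_of_nonneg (sq_nonneg (g x))]
          gcongr; nlinarith [sq_nonneg (f x)]
        exact (abs_le.1 this).2
      have e6 := mul_le_mul_of_nonneg_right hN hE0
      linarith
  have hzero : ∀ x ∈ Ioc 0 x₀, f x = 0 := by
    intro x hx
    have h1 := hmono (Ioc_subset_Icc_self hx) (right_mem_Icc.2 hx₀.le) hx.2
    simp only [hf, hg] at h1
    have hx' : 0 < x ^ (N + 1) := pow_pos hx.1 _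
    have h2 : f x ^ 2 + g x ^ 2 ≤ 0 := by
      by_contra hcon
      push Not at hcon
      have := mul_pos hx' hcon
      simp at h1
      linarith
    have : f x ^ 2 = 0 := by nlinarith [sq_nonneg (f x), sq_nonneg (g x)]
    exact pow_eq_zero_iff (two_ne_zero) |>.1 this
  have hlim : Tendsto f (𝓝[>] 0) (𝓝 1) := by
    have := h.continuous_left.tendsto 0
    rw [h.left_zero] at this
    exact this.mono_left nhdsWithin_le_nhds
  have hlim0 : Tendsto f (𝓝[>] 0) (𝓝 0) := by
    refine tendsto_const_nhds.congr' ?_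
    filter_upwards [Ioc_mem_nhdsGT hx₀] with x hx using (hzero x hx).symm
  exact one_ne_zero (tendsto_nhds_unique hlim hlim0)

/-- Riccati argument: if `f` had no zero beyond `X`, the logarithmic derivative `p` of
`x ^ (ℓ + 1) * f x` would satisfy `p' ≤ -1/4 - p ^ 2` on a half-line. -/
theorem exists_left_zero_gt (h : IsCoulombPair a m f g) (hm : m ≠ 0) (X : ℝ) :
    ∃ x, X < x ∧ f x = 0 := by
  by_contra! hne
  set c := (1 + a ^ 2) / m with hc
  have hcm : c * m = 1 + a ^ 2 := by rw [hc]; field_simp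
  set B := |a * (m - 1)| + |(m - 1) * (m - 3) / 4| with hB
  set Y := max (X + 1) (max 1 (2 * B)) with hY
  have hYX : X < Y := lt_of_lt_of_le (by linarith) (le_max_left _ _)
  have hY1 : 1 ≤ Y := (le_max_left _ _).trans (le_max_right _ _)
  have hYB : 2 * B ≤ Y := (le_max_right _ _).trans (le_max_right _ _)
  set p : ℝ → ℝ := fun x => a + (m - 1) / 2 * x⁻¹ - c * x * (g x / f x) with hp
  have hpd : ∀ x, Y ≤ x → HasDerivAt p
      (-(1 - a * (m - 1) / x - (m - 1) * (m - 3) / 4 / x ^ 2) - p x ^ 2) x := by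
    intro x hx
    have hx0 : x ≠ 0 := by linarith
    have hfx : f x ≠ 0 := hne x (hYX.trans_le hx)
    have h1 := ((hasDerivAt_inv hx0).const_mul ((m - 1) / 2)).const_add a
    have h2 := ((hasDerivAt_id x).const_mul c).mul
      ((h.hasDerivAt_right x hx0).div (h.hasDerivAt_left x) hfx)
    refine (h1.sub h2).congr_deriv ?_
    simp only [hp, id, Pi.div_apply]
    rw [← hc]
    field_simp
    linear_combination (-16 * x ^ 2 * f x ^ 2) * hcm
  have hanti : AntitoneOn (fun x => arctan (2 * p x) + x / 2) (Ici Y) := by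
    have hd : ∀ x, Y ≤ x → HasDerivAt (fun x => arctan (2 * p x) + x / 2)
        (1 / (1 + (2 * p x) ^ 2) * (2 * (-(1 - a * (m - 1) / x
          - (m - 1) * (m - 3) / 4 / x ^ 2) - p x ^ 2)) + 1 / 2) x := fun x hx =>
      (((hpd x hx).const_mul 2).arctan).add ((hasDerivAt_id x).div_const 2)
    refine antitoneOn_of_hasDerivWithinAt_nonpos (convex_Ici _)
      (fun x hx => (hd x hx).continuousAt.continuousWithinAt)
      (fun x hx => (hd x (interior_subset hx)).hasDerivWithinAt) ?_
    intro x hx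
    have hx : Y ≤ x := interior_subset hx
    have hx1 : 1 ≤ x := hY1.trans hx
    have hx0 : 0 < x := by linarith
    have b1 : a * (m - 1) / x ≤ |a * (m - 1)| / x := by gcongr; exact le_abs_self _
    have b2 : (m - 1) * (m - 3) / 4 / x ^ 2 ≤ |(m - 1) * (m - 3) / 4| / x := by
      have : (m - 1) * (m - 3) / 4 / x ^ 2 ≤ |(m - 1) * (m - 3) / 4| / x ^ 2 := by
        gcongr; exact le_abs_self _
      refine this.trans ?_
      gcongr
      nlinarith
    have b3 : B / x ≤ 1 / 2 := by
      rw [div_le_div_iff₀ hx0 two_pos]; linarith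
    have b4 : |a * (m - 1)| / x + |(m - 1) * (m - 3) / 4| / x = B / x := by
      rw [hB]; ring
    have hpos : 0 < 1 + (2 * p x) ^ 2 := by positivity
    rw [div_mul_eq_mul_div, one_mul, div_add_div _ _ hpos.ne' two_ne_zero]
    refine div_nonpos_of_nonpos_of_nonneg ?_ (by positivity)
    nlinarith
  have hlt := hanti (self_mem_Ici) (mem_Ici.2 (by linarith [pi_pos] : Y ≤ Y + 2 * π))
    (by linarith [pi_pos])
  simp only at hlt
  have h1 := arctan_lt_pi_div_two (2 * p Y)
  have h2 := neg_pi_div_two_lt_arctan (2 * p (Y + 2 * π))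
  linarith

theorem hasDerivAt_left_exp (h : IsCoulombPair a m f g) (x : ℝ) :
    HasDerivAt (fun y => f y * exp (-(a * y))) (-((1 + a ^ 2) / m) * x * exp (-(a * x)) * g x)
      x := by
  have h1 := (h.hasDerivAt_left x).mul (((hasDerivAt_id x).const_mul a).neg.exp)
  refine h1.congr_deriv ?_
  simp only [id, Pi.neg_apply]
  ring

theorem hasDerivAt_right_exp (h : IsCoulombPair a m f g) {x : ℝ} (hx : 0 < x) :
    HasDerivAt (fun y => g y * (exp (a * y) * y ^ m)) (m * x ^ (m - 1) * exp (a * x) * f x) x := by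
  have h1 := (h.hasDerivAt_right x hx.ne').mul
    ((((hasDerivAt_id x).const_mul a).exp).mul (hasDerivAt_rpow_const (p := m) (Or.inl hx.ne')))
  refine h1.congr_deriv ?_
  have h2 : x ^ m = x ^ (m - 1) * x := by
    rw [rpow_sub_one hx.ne']; field_simp
  simp only [id, Pi.mul_apply]
  rw [h2]
  field_simp
  ring

theorem exists_right_zero_between (h : IsCoulombPair a m f g) (hm : m ≠ 0) {x y : ℝ}
    (hx : 0 < x) (hxy : x < y) (hfx : f x = 0) (hfy : f y = 0) : ∃ z ∈ Ioo x y, g z = 0 := by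
  obtain ⟨z, hz, hz'⟩ := exists_hasDerivAt_eq_zero hxy
    (fun t _ => (h.hasDerivAt_left_exp t).continuousAt.continuousWithinAt)
    (by simp [hfx, hfy]) (fun t _ => h.hasDerivAt_left_exp t)
  refine ⟨z, hz, (mul_eq_zero.1 hz').resolve_left ?_⟩
  have hz0 : z ≠ 0 := (hx.trans hz.1).ne'
  exact mul_ne_zero (mul_ne_zero (neg_ne_zero.2 (div_ne_zero (by positivity) hm)) hz0)
    (exp_ne_zero _)

theorem exists_left_zero_between (h : IsCoulombPair a m f g) (hm : m ≠ 0) {x y : ℝ}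
    (hx : 0 < x) (hxy : x < y) (hgx : g x = 0) (hgy : g y = 0) : ∃ z ∈ Ioo x y, f z = 0 := by
  obtain ⟨z, hz, hz'⟩ := exists_hasDerivAt_eq_zero hxy
    (fun t ht => (h.hasDerivAt_right_exp (hx.trans_le ht.1)).continuousAt.continuousWithinAt)
    (by simp [hgx, hgy]) (fun t ht => h.hasDerivAt_right_exp (hx.trans ht.1))
  refine ⟨z, hz, (mul_eq_zero.1 hz').resolve_left ?_⟩
  have hz0 : 0 < z := hx.trans hz.1
  exact mul_ne_zero (mul_ne_zero hm (rpow_pos_of_pos hz0 _).ne') (exp_ne_zero _)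

theorem exists_right_zero_gt (h : IsCoulombPair a m f g) (hm : m ≠ 0) (X : ℝ) :
    ∃ x, X < x ∧ g x = 0 := by
  obtain ⟨x, hx, hfx⟩ := h.exists_left_zero_gt hm (max X 0)
  obtain ⟨y, hy, hfy⟩ := h.exists_left_zero_gt hm x
  obtain ⟨z, hz, hgz⟩ := h.exists_right_zero_between hm ((le_max_right _ _).trans_lt hx) hy hfx hfy
  exact ⟨z, ((le_max_left _ _).trans_lt hx).trans hz.1, hgz⟩

/-- For `m < 0`, the function `f` has no zero up to the first positive zero of `g`. -/
theorem left_pos_of_right_ne_zero (h : IsCoulombPair a m f g) (hm : m < 0) {x : ℝ} (hx : 0 < x)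
    (hg : ∀ y, 0 < y → y < x → g y ≠ 0) : 0 < f x := by
  have hgpos : ∀ y ∈ Ioo 0 x, 0 < g y := by
    intro y hy
    by_contra! hle
    obtain ⟨z, hz, hgz⟩ := intermediate_value_Icc' hy.1.le h.continuous_right.continuousOn
      (show (0 : ℝ) ∈ Icc (g y) (g 0) from ⟨hle, by rw [h.right_zero]; exact zero_le_one⟩)
    have hz0 : z ≠ 0 := by
      rintro rfl
      rw [h.right_zero] at hgz
      exact one_ne_zero hgz
    exact hg z (lt_of_le_of_ne hz.1 hz0.symm) (hz.2.trans_lt hy.2) hgz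
  have hmono := monotoneOn_of_hasDerivWithinAt_nonneg (convex_Icc 0 x)
    (fun t _ => (h.hasDerivAt_left_exp t).continuousAt.continuousWithinAt)
    (fun t _ => (h.hasDerivAt_left_exp t).hasDerivWithinAt) (by
      intro t ht
      rw [interior_Icc] at ht
      have h1 := hgpos t ht
      have h2 : 0 < -((1 + a ^ 2) / m) := neg_pos.2 (div_neg_of_pos_of_neg (by positivity) hm)
      have h3 := ht.1
      positivity)
  have h1 := hmono (left_mem_Icc.2 hx.le) (right_mem_Icc.2 hx.le) hx.le
  simp only [h.left_zero, mul_zero, neg_zero, exp_zero, mul_one] at h1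
  exact pos_of_mul_pos_left (zero_lt_one.trans_le h1) (exp_pos _).le

end IsCoulombPair

theorem Continuous.exists_first_zero_gt {h : ℝ → ℝ} (hc : Continuous h) {x : ℝ} (hx : h x ≠ 0)
    (hex : ∃ y, x < y ∧ h y = 0) : ∃ z, x < z ∧ h z = 0 ∧ ∀ y, x < y → y < z → h y ≠ 0 := by
  obtain ⟨y₀, hy₀, hy₀'⟩ := hex
  set S := Ici x ∩ h ⁻¹' {0} with hS
  have hcl : IsClosed S := isClosed_Ici.inter (isClosed_singleton.preimage hc)
  have hbdd : BddBelow S := ⟨x, fun _ hy => hy.1⟩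
  have hmem : sInf S ∈ S := hcl.csInf_mem ⟨y₀, hy₀.le, hy₀'⟩ hbdd
  refine ⟨sInf S, lt_of_le_of_ne hmem.1 ?_, hmem.2, ?_⟩
  · intro heq
    exact hx (heq ▸ hmem.2)
  · intro y hxy hy hzero
    exact hy.not_ge (csInf_le hbdd ⟨hxy.le, hzero⟩)

theorem IsCoulombPair.exists_interlacing_enum {a m : ℝ} {f g : ℝ → ℝ}
    (h : IsCoulombPair a m f g) (hm : m < 0) :
    ∃ ρ₁ ρ₂ : ℕ → ℝ, IsPosZeroEnum f ρ₁ ∧ IsPosZeroEnum g ρ₂ ∧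
      ∀ k, ρ₂ k < ρ₁ k ∧ ρ₁ k < ρ₂ (k + 1) := by
  have hfc := h.continuous_left
  have hgc := h.continuous_right
  obtain ⟨r, hr0, hgr, hrmin⟩ := hgc.exists_first_zero_gt (x := 0)
    (by rw [h.right_zero]; exact one_ne_zero) (h.exists_right_zero_gt hm.ne 0)
  have hnf : ∀ x, ∃ z, 0 < x → g x = 0 →
      x < z ∧ f z = 0 ∧ ∀ y, x < y → y < z → f y ≠ 0 := by
    intro x
    by_cases hx : 0 < x ∧ g x = 0
    · obtain ⟨z, hz⟩ := hfc.exists_first_zero_gt (fun hf => h.right_ne_zero hx.1 hf hx.2)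
        (h.exists_left_zero_gt hm.ne x)
      exact ⟨z, fun _ _ => hz⟩
    · exact ⟨0, fun h1 h2 => (hx ⟨h1, h2⟩).elim⟩
  have hng : ∀ x, ∃ z, 0 < x → f x = 0 →
      x < z ∧ g z = 0 ∧ ∀ y, x < y → y < z → g y ≠ 0 := by
    intro x
    by_cases hx : 0 < x ∧ f x = 0
    · obtain ⟨z, hz⟩ := hgc.exists_first_zero_gt (h.right_ne_zero hx.1 hx.2)
        (h.exists_right_zero_gt hm.ne x)
      exact ⟨z, fun _ _ => hz⟩
    · exact ⟨0, fun h1 h2 => (hx ⟨h1, h2⟩).elim⟩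
  choose nf hnf using hnf
  choose ng hng using hng
  obtain ⟨ρ₂, h0, hsucc⟩ : ∃ ρ : ℕ → ℝ, ρ 0 = r ∧ ∀ k, ρ (k + 1) = ng (nf (ρ k)) :=
    ⟨fun k => Nat.rec r (fun _ x => ng (nf x)) k, rfl, fun _ => rfl⟩
  set ρ₁ : ℕ → ℝ := fun k => nf (ρ₂ k) with hρ₁
  have hpos₂ : ∀ k, 0 < ρ₂ k ∧ g (ρ₂ k) = 0 := by
    intro k
    induction k with
    | zero => rw [h0]; exact ⟨hr0, hgr⟩
    | succ k ih =>
      obtain ⟨h1, h2, -⟩ := hnf _ ih.1 ih.2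
      obtain ⟨h3, h4, -⟩ := hng _ (ih.1.trans h1) h2
      rw [hsucc]
      exact ⟨(ih.1.trans h1).trans h3, h4⟩
  have hf₁ : ∀ k, ρ₂ k < ρ₁ k ∧ f (ρ₁ k) = 0 ∧ ∀ y, ρ₂ k < y → y < ρ₁ k → f y ≠ 0 :=
    fun k => hnf _ (hpos₂ k).1 (hpos₂ k).2
  have hpos₁ : ∀ k, 0 < ρ₁ k := fun k => (hpos₂ k).1.trans (hf₁ k).1
  have hg₂ : ∀ k, ρ₁ k < ρ₂ (k + 1) ∧ ∀ y, ρ₁ k < y → y < ρ₂ (k + 1) → g y ≠ 0 := by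
    intro k
    rw [hsucc]
    have := hng (ρ₁ k) (hpos₁ k) (hf₁ k).2.1
    exact ⟨this.1, this.2.2⟩
  have hmono₂ : StrictMono ρ₂ := strictMono_nat_of_lt_succ fun k => (hf₁ k).1.trans (hg₂ k).1
  have hmono₁ : StrictMono ρ₁ := strictMono_nat_of_lt_succ fun k => (hg₂ k).1.trans (hf₁ (k + 1)).1
  have hunb : ∀ x, ∃ k, x < ρ₂ k := by
    by_contra! hcon
    obtain ⟨b, hb⟩ := hcon
    have hlim₂ := tendsto_atTop_ciSup hmono₂.monotone ⟨b, by rintro _ ⟨k, rfl⟩; exact hb k⟩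
    have hlim₁ : Tendsto ρ₁ atTop (𝓝 (⨆ i, ρ₂ i)) :=
      tendsto_of_tendsto_of_tendsto_of_le_of_le hlim₂ (hlim₂.comp (tendsto_add_atTop_nat 1))
        (fun k => (hf₁ k).1.le) (fun k => (hg₂ k).1.le)
    have hL : 0 < ⨆ i, ρ₂ i := (hpos₂ 0).1.trans_le
      (hmono₂.monotone.ge_of_tendsto hlim₂ 0)
    refine h.right_ne_zero hL
      (tendsto_nhds_unique ((hfc.tendsto _).comp hlim₁) ?_)
      (tendsto_nhds_unique ((hgc.tendsto _).comp hlim₂) ?_)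
    · simp [Function.comp_def, (hf₁ _).2.1]
    · simp [Function.comp_def, (hpos₂ _).2]
  have hcover : ∀ x, 0 < x → (f x = 0 → ∃ k, ρ₁ k = x) ∧ (g x = 0 → ∃ k, ρ₂ k = x) := by
    intro x hx
    classical
    obtain ⟨n, hn, hmin⟩ : ∃ n, x < ρ₂ n ∧ ∀ k < n, ρ₂ k ≤ x :=
      ⟨Nat.find (hunb x), Nat.find_spec (hunb x), fun k hk => not_lt.1 (Nat.find_min (hunb x) hk)⟩
    rcases n with _ | k
    · rw [h0] at hn
      exact ⟨fun hf => absurd hf (h.left_pos_of_right_ne_zero hm hx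
        fun y hy hyx => hrmin y hy (hyx.trans hn)).ne', fun hg => absurd hg (hrmin x hx hn)⟩
    · rcases (hmin k k.lt_succ_self).eq_or_lt with heq | hlt
      · exact ⟨fun hf => absurd (heq ▸ (hpos₂ k).2) (h.right_ne_zero hx hf), fun _ => ⟨k, heq⟩⟩
      rcases lt_trichotomy x (ρ₁ k) with hlt' | heq | hgt
      · refine ⟨fun hf => absurd hf ((hf₁ k).2.2 x hlt hlt'), fun hg => ?_⟩
        obtain ⟨z, hz, hfz⟩ := h.exists_left_zero_between hm.ne (hpos₂ k).1 hlt (hpos₂ k).2 hg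
        exact absurd hfz ((hf₁ k).2.2 z hz.1 (hz.2.trans hlt'))
      · exact ⟨fun _ => ⟨k, heq.symm⟩,
          fun hg => absurd hg (h.right_ne_zero hx (heq ▸ (hf₁ k).2.1))⟩
      · refine ⟨fun hf => ?_, fun hg => absurd hg ((hg₂ k).2 x hgt hn)⟩
        obtain ⟨z, hz, hgz⟩ := h.exists_right_zero_between hm.ne (hpos₁ k) hgt (hf₁ k).2.1 hf
        exact absurd hgz ((hg₂ k).2 z hz.1 (hz.2.trans hn))
  exact ⟨ρ₁, ρ₂, ⟨hmono₁, fun k => ⟨hpos₁ k, (hf₁ k).2.1⟩, fun x hx => (hcover x hx).1⟩,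
    ⟨hmono₂, hpos₂, fun x hx => (hcover x hx).2⟩, fun k => ⟨(hf₁ k).1, (hg₂ k).1⟩⟩

/-- The coefficients decay faster than any geometric sequence. -/
theorem abs_coulombCoeff_le (l η : ℝ) {q : ℝ} (hq : 0 < q) :
    ∃ C, 0 ≤ C ∧ ∀ k, |coulombCoeff l η k| ≤ C * q ^ k := by
  set M := 2 * |η| / q + 1 / q ^ 2 with hM
  have hM0 : 0 ≤ M := by positivity
  obtain ⟨K, hK⟩ := exists_nat_ge (M + |2 * l|)
  set C := ∑ i ∈ Finset.range (K + 2), |coulombCoeff l η i| / q ^ i with hC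
  have hC0 : 0 ≤ C := Finset.sum_nonneg fun i _ => by positivity
  refine ⟨C, hC0, fun k => ?_⟩
  induction k using Nat.strong_induction_on with
  | _ n ih =>
    by_cases hn : n < K + 2
    · rw [← div_le_iff₀ (pow_pos hq n)]
      exact Finset.single_le_sum (f := fun i => |coulombCoeff l η i| / q ^ i)
        (fun i _ => by positivity) (Finset.mem_range.2 hn)
    · obtain ⟨k, rfl⟩ : ∃ k, n = k + 2 := ⟨n - 2, by omega⟩
      have hk : (K : ℝ) ≤ k := by exact_mod_cast (by omega : K ≤ k)
      have hl := neg_abs_le (2 * l)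
      have hD : M ≤ ((k : ℝ) + 2) * (((k : ℝ) + 2) + 2 * l + 1) := by
        nlinarith [abs_nonneg (2 * l)]
      have hDpos : 0 < ((k : ℝ) + 2) * (((k : ℝ) + 2) + 2 * l + 1) :=
        mul_pos (by positivity) (by linarith)
      rw [coulombCoeff, abs_div, abs_of_pos hDpos, div_le_iff₀ hDpos]
      have h1 := ih (k + 1) (by omega)
      have h0 := ih k (by omega)
      calc |2 * η * coulombCoeff l η (k + 1) - coulombCoeff l η k|
          ≤ |2 * η * coulombCoeff l η (k + 1)| + |coulombCoeff l η k| := abs_sub _ _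
        _ = 2 * |η| * |coulombCoeff l η (k + 1)| + |coulombCoeff l η k| := by
          rw [abs_mul, abs_mul, abs_two]
        _ ≤ 2 * |η| * (C * q ^ (k + 1)) + C * q ^ k := by gcongr
        _ = C * q ^ (k + 2) * M := by rw [hM]; field_simp; ring
        _ ≤ _ := by gcongr

theorem summable_coulombPhi (l η x : ℝ) : Summable fun k => coulombCoeff l η k * x ^ k := by
  obtain ⟨C, hC, hb⟩ := abs_coulombCoeff_le l η (q := 1 / (2 * (|x| + 1))) (by positivity)
  refine Summable.of_norm_bounded (g := fun k => C * (1 / 2) ^ k)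
    ((summable_geometric_of_lt_one (by norm_num) (by norm_num)).mul_left C) fun k => ?_
  rw [norm_mul, norm_pow, Real.norm_eq_abs, Real.norm_eq_abs]
  calc |coulombCoeff l η k| * |x| ^ k
      ≤ C * (1 / (2 * (|x| + 1))) ^ k * (|x| + 1) ^ k := by
        gcongr
        · exact hb k
        · linarith
    _ = C * (1 / 2) ^ k := by
      rw [mul_assoc, ← mul_pow]
      congr 2
      field_simp

theorem coulombPhi_eq_one_add (l η x : ℝ) :
    coulombPhi l η x = 1 + ∑' k, coulombCoeff l η (k + 1) * x ^ (k + 1) := by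
  rw [coulombPhi, (summable_coulombPhi l η x).tsum_eq_zero_add]
  simp [coulombCoeff]

theorem hasDerivAt_coulombPhi (l η x : ℝ) :
    ∃ d, HasSum (fun k : ℕ => ((k : ℝ) + 1) * coulombCoeff l η (k + 1) * x ^ k) d ∧
      HasDerivAt (coulombPhi l η) d x := by
  obtain ⟨R, hR⟩ : ∃ R, R = |x| + 1 := ⟨_, rfl⟩
  have hR0 : 0 < R := by rw [hR]; positivity
  obtain ⟨C, hC, hb⟩ := abs_coulombCoeff_le l η (q := 1 / (2 * R)) (by positivity)
  have hu : Summable fun k : ℕ => C / R * ((k : ℝ) ^ 1 * (1 / 2) ^ k) :=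
    (summable_pow_mul_geometric_of_norm_lt_one (R := ℝ) (r := 1 / 2) 1
      (by rw [Real.norm_eq_abs, abs_of_pos] <;> norm_num)).mul_left _
  have hbound : ∀ (n : ℕ) (y : ℝ), y ∈ Metric.ball (0 : ℝ) R →
      ‖coulombCoeff l η n * (n * y ^ (n - 1))‖ ≤ C / R * ((n : ℝ) ^ 1 * (1 / 2) ^ n) := by
    intro n y hy
    rw [mem_ball_zero_iff, Real.norm_eq_abs] at hy
    rcases n with _ | n
    · simp
    simp only [norm_mul, norm_pow, Real.norm_eq_abs, Nat.abs_cast, Nat.add_sub_cancel]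
    calc |coulombCoeff l η (n + 1)| * (((n + 1 : ℕ) : ℝ) * |y| ^ n)
        ≤ C * (1 / (2 * R)) ^ (n + 1) * (((n + 1 : ℕ) : ℝ) * R ^ n) := by
          gcongr
          exact hb (n + 1)
      _ = _ := by
        rw [div_pow, div_pow, mul_pow]
        field_simp
        ring
  have hx : x ∈ Metric.ball (0 : ℝ) R := by
    rw [mem_ball_zero_iff, Real.norm_eq_abs]; linarith
  have hd : HasDerivAt (coulombPhi l η)
      (∑' n : ℕ, coulombCoeff l η n * (n * x ^ (n - 1))) x :=
    hasDerivAt_tsum_of_isPreconnected hu Metric.isOpen_ball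
    (convex_ball (0 : ℝ) R).isPreconnected
    (fun n y _ => (hasDerivAt_pow n y).const_mul (coulombCoeff l η n)) hbound hx
    (summable_coulombPhi l η x) hx
  have hs : Summable fun n : ℕ => coulombCoeff l η n * (n * x ^ (n - 1)) :=
    Summable.of_norm_bounded hu fun n => hbound n x hx
  have hshift : ∀ k : ℕ, coulombCoeff l η (k + 1) * ((k + 1 : ℕ) * x ^ (k + 1 - 1)) =
      ((k : ℝ) + 1) * coulombCoeff l η (k + 1) * x ^ k := fun k => by
    rw [Nat.add_sub_cancel]
    push_cast
    ring
  refine ⟨_, (((summable_nat_add_iff 1).2 hs).congr hshift).hasSum, hd.congr_deriv ?_⟩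
  rw [hs.tsum_eq_zero_add, tsum_congr hshift]
  simp

theorem coulombCoeff_rec {l η : ℝ} (k : ℕ) (h : (k : ℝ) + 2 + 2 * l + 1 ≠ 0) :
    ((k : ℝ) + 2) * ((k : ℝ) + 2 + 2 * l + 1) * coulombCoeff l η (k + 2) =
      2 * η * coulombCoeff l η (k + 1) - coulombCoeff l η k := by
  rw [coulombCoeff]
  have : (k : ℝ) + 2 ≠ 0 := by positivity
  field_simp

theorem coulombCoeff_contiguous {l η : ℝ} (hl : ∀ n : ℕ, 2 * l + 2 ≠ -(n : ℝ)) (k : ℕ) :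
    ((k : ℝ) + 2) * coulombCoeff l η (k + 2) = η / (l + 1) * coulombCoeff l η (k + 1) -
      (1 + (η / (l + 1)) ^ 2) / (2 * l + 3) * coulombCoeff (l + 1) η k ∧
    ((k : ℝ) + 1 + (2 * l + 3)) * coulombCoeff (l + 1) η (k + 1) =
      (2 * l + 3) * coulombCoeff l η (k + 1) - η / (l + 1) * coulombCoeff (l + 1) η k := by
  have h1 : l + 1 ≠ 0 := fun h => hl 0 (by push_cast; linarith)
  have h3 : 2 * l + 3 ≠ 0 := fun h => hl 1 (by push_cast; linarith)
  have h2 : l + 1 + 1 ≠ 0 := fun h => hl 2 (by push_cast; linarith)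
  set a := η / (l + 1) with ha
  set c := (1 + a ^ 2) / (2 * l + 3) with hc
  have hη : η = a * (l + 1) := by rw [ha]; field_simp
  have hcm : c * (2 * l + 3) = 1 + a ^ 2 := by rw [hc]; field_simp
  induction k with
  | zero =>
    have r := coulombCoeff_rec (l := l) (η := η) 0
      (fun h => hl 1 (by push_cast at h ⊢; linarith))
    simp only [coulombCoeff, ← ha] at r ⊢
    push_cast at r ⊢
    constructor
    · apply mul_right_cancel₀ h3
      linear_combination r + hcm + 2 * a * hη
    · field_simp
      linear_combination (2 * l + 4) * hη
  | succ k ih =>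
    obtain ⟨ihA, ihB⟩ := ih
    have hk : (k : ℝ) + 1 + (2 * l + 3) ≠ 0 :=
      fun h => hl (k + 2) (by push_cast; linarith)
    have ra := coulombCoeff_rec (l := l) (η := η) (k + 1)
      (fun h => hl (k + 2) (by push_cast at h ⊢; linarith))
    have rb := coulombCoeff_rec (l := l + 1) (η := η) k
      (fun h => hl (k + 3) (by push_cast at h ⊢; linarith))
    have hk2 : (k : ℝ) + 2 ≠ 0 := by positivity
    simp only [Nat.add_assoc, Nat.reduceAdd] at *
    push_cast at *
    constructor
    · apply mul_right_cancel₀ hk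
      linear_combination ra + c * ihB - a * ihA + 2 * coulombCoeff l η (k + 2) * hη
        + coulombCoeff l η (k + 1) * hcm
    · apply mul_right_cancel₀ hk2
      linear_combination rb - (2 * l + 3) * ihA + a * ihB
        + 2 * coulombCoeff (l + 1) η (k + 1) * hη + coulombCoeff (l + 1) η k * hcm

theorem isCoulombPair_coulombPhi {l η : ℝ} (hl : ∀ n : ℕ, 2 * l + 2 ≠ -(n : ℝ)) :
    IsCoulombPair (η / (l + 1)) (2 * l + 3) (coulombPhi l η) (coulombPhi (l + 1) η) where
  hasDerivAt_left x := by
    obtain ⟨d, hd, hderiv⟩ := hasDerivAt_coulombPhi l η x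
    convert! hderiv using 1
    have hf := ((summable_nat_add_iff 1).2 (summable_coulombPhi l η x)).hasSum
    have hg := (summable_coulombPhi (l + 1) η x).hasSum
    have hd' := (hasSum_nat_add_iff' 1).2 hd
    have h := (hf.mul_left (η / (l + 1))).sub
      (hg.mul_left ((1 + (η / (l + 1)) ^ 2) / (2 * l + 3) * x))
    have heq := h.unique (hd'.congr_fun (fun k => by
      push_cast
      linear_combination -x ^ (k + 1) * (coulombCoeff_contiguous (η := η) hl k).1))
    rw [← coulombPhi] at heq
    rw [coulombPhi_eq_one_add l]
    simp only [Finset.sum_range_one, CharP.cast_eq_zero, zero_add, coulombCoeff] at heq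
    linear_combination heq
  hasDerivAt_right x hx := by
    obtain ⟨d, hd, hderiv⟩ := hasDerivAt_coulombPhi (l + 1) η x
    convert! hderiv using 1
    have hf := ((summable_nat_add_iff 1).2 (summable_coulombPhi l η x)).hasSum
    have hg := (summable_coulombPhi (l + 1) η x).hasSum
    have hg' := ((summable_nat_add_iff 1).2 (summable_coulombPhi (l + 1) η x)).hasSum
    have h := ((hf.mul_left (2 * l + 3)).sub (hg'.mul_left (2 * l + 3))).sub
      (hg.mul_left (η / (l + 1) * x))
    have heq := h.unique ((hd.mul_left x).congr_fun (fun k => by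
      linear_combination -x ^ (k + 1) * (coulombCoeff_contiguous (η := η) hl k).2))
    rw [div_eq_iff hx, coulombPhi_eq_one_add l]
    have h1 := coulombPhi_eq_one_add (l + 1) η x
    rw [← coulombPhi] at heq
    linear_combination heq - (2 * l + 3) * h1
  continuous_right := continuous_iff_continuousAt.2 fun x => by
    obtain ⟨d, -, h⟩ := hasDerivAt_coulombPhi (l + 1) η x
    exact h.continuousAt
  left_zero := by simp [coulombPhi_eq_one_add]
  right_zero := by simp [coulombPhi_eq_one_add]

theorem coulombCoeff_neg (l η : ℝ) (k : ℕ) :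
    coulombCoeff l (-η) k = (-1) ^ k * coulombCoeff l η k := by
  induction k using Nat.twoStepInduction with
  | zero => simp [coulombCoeff]
  | one => simp [coulombCoeff, neg_div]
  | more k h0 h1 =>
    rw [coulombCoeff, coulombCoeff, h0, h1]
    ring

theorem coulombPhi_neg (l η x : ℝ) : coulombPhi l η (-x) = coulombPhi l (-η) x := by
  simp only [coulombPhi, coulombCoeff_neg]
  refine tsum_congr fun k => ?_
  rw [neg_pow]
  ring

theorem coulombPhi_deriv_ne_zero_of_pos {l η : ℝ} (hl : ∀ n : ℕ, 2 * l + 2 ≠ -(n : ℝ)) {x : ℝ}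
    (hx : 0 < x) (hzero : coulombPhi l η x = 0) : deriv (coulombPhi l η) x ≠ 0 := by
  have h := isCoulombPair_coulombPhi (η := η) hl
  have h3 : 2 * l + 3 ≠ 0 := fun h => hl 1 (by push_cast; linarith)
  rw [(h.hasDerivAt_left x).deriv, hzero, mul_zero, zero_sub, neg_ne_zero]
  exact mul_ne_zero (mul_ne_zero (div_ne_zero (by positivity) h3) hx.ne')
    (h.right_ne_zero hx hzero)

theorem coulombPhi_deriv_ne_zero {l η : ℝ} (hl : ∀ n : ℕ, 2 * l + 2 ≠ -(n : ℝ)) {x : ℝ}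
    (hzero : coulombPhi l η x = 0) : deriv (coulombPhi l η) x ≠ 0 := by
  rcases lt_trichotomy x 0 with hx | rfl | hx
  · have h := coulombPhi_deriv_ne_zero_of_pos (η := -η) hl (neg_pos.2 hx)
      (by rw [← coulombPhi_neg, neg_neg, hzero])
    have heq : coulombPhi l (-η) = fun y => coulombPhi l η (-y) :=
      funext fun y => (coulombPhi_neg l η y).symm
    rw [heq, deriv_comp_neg, neg_neg] at h
    exact neg_ne_zero.1 h
  · rw [(isCoulombPair_coulombPhi (η := η) hl).left_zero] at hzero
    exact absurd hzero one_ne_zero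
  · exact coulombPhi_deriv_ne_zero_of_pos hl hx hzero

/-- Theorem 3.2: for ℓ ≤ −3/2, η ≠ 0 (with 2ℓ+2 not a nonpositive integer), φ_{ℓ,η} has
countably infinitely many real zeros, all simple, and the positive zeros of φ_{ℓ,η} and
φ_{ℓ+1,η} interlace as 0 < ρ_{ℓ+1,η,1} < ρ_{ℓ,η,1} < ρ_{ℓ+1,η,2} < ρ_{ℓ,η,2} < ⋯ . -/
theorem stmt_7 (l η : ℝ) (hl : l ≤ -3/2) (hη : η ≠ 0)
    (hl2 : ∀ n : ℕ, 2 * l + 2 ≠ -(n : ℝ)) :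
    {x : ℝ | coulombPhi l η x = 0}.Infinite ∧
      {x : ℝ | coulombPhi l η x = 0}.Countable ∧
      (∀ x : ℝ, coulombPhi l η x = 0 → deriv (coulombPhi l η) x ≠ 0) ∧
      ∃ ρ₁ ρ₂ : ℕ → ℝ,
        IsPosZeroEnum (coulombPhi l η) ρ₁ ∧ IsPosZeroEnum (coulombPhi (l + 1) η) ρ₂ ∧
          ∀ k, ρ₂ k < ρ₁ k ∧ ρ₁ k < ρ₂ (k + 1) := by
  have hm : 2 * l + 3 < 0 :=
    lt_of_le_of_ne (by linarith) fun h => hl2 1 (by push_cast; linarith)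
  have hpair := isCoulombPair_coulombPhi (η := η) hl2
  obtain ⟨ρ₁, ρ₂, h₁, h₂, hint⟩ := hpair.exists_interlacing_enum hm
  obtain ⟨σ, -, hσ, -, -⟩ :=
    (isCoulombPair_coulombPhi (η := -η) hl2).exists_interlacing_enum hm
  refine ⟨?_, ?_, fun x => coulombPhi_deriv_ne_zero hl2, ρ₁, ρ₂, h₁, h₂, hint⟩
  · exact (infinite_range_of_injective h₁.1.injective).mono
      (range_subset_iff.2 fun k => (h₁.2.1 k).2)
  · refine ((countable_range ρ₁).union (countable_range fun k => -σ k)).mono fun x hx => ?_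
    rcases lt_trichotomy x 0 with hx0 | rfl | hx0
    · obtain ⟨k, hk⟩ := hσ.2.2 (-x) (neg_pos.2 hx0)
        (by rw [← coulombPhi_neg, neg_neg]; exact hx)
      exact Or.inr ⟨k, by simp [hk]⟩
    · exact absurd (hpair.left_zero.symm.trans hx) one_ne_zero
    · exact Or.inl (h₁.2.2 x hx0 hx)
end

section
/- Let η ∈ ℝ and let −1/2 < ℓ < L with L − ℓ ≤ 1. Then the positive zeros of φ_{ℓ,η} and φ_{L,η} strictly interlace according to the pattern 0 < ρ_{ℓ,η,1} < ρ_{L,η,1} < ρ_{ℓ,η,2} < ρ_{L,η,2} < ⋯ ; that is, ρ_{ℓ,η,k} < ρ_{L,η,k} < ρ_{ℓ,η,k+1} for every k ≥ 1. -/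
open Set Filter Topology

/-- Exponential-type decay of a coefficient sequence. -/
def ExpBounded (a : ℕ → ℝ) : Prop :=
  ∃ C M : ℝ, 0 ≤ C ∧ 0 ≤ M ∧ ∀ k, |a k| ≤ C * (M ^ k / (k.factorial : ℝ))

/-- The coefficients of the formal derivative. -/
def derivCoeff (a : ℕ → ℝ) (k : ℕ) : ℝ := ((k : ℝ) + 1) * a (k + 1)

theorem ExpBounded.summable_abs {a : ℕ → ℝ} (ha : ExpBounded a) (r : ℝ) :
    Summable fun k => |a k| * |r| ^ k := by
  obtain ⟨C, M, hC, hM, h⟩ := ha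
  refine Summable.of_nonneg_of_le (fun k => by positivity) (fun k => ?_)
    ((Real.summable_pow_div_factorial (M * |r|)).mul_left C)
  calc |a k| * |r| ^ k ≤ C * (M ^ k / (k.factorial : ℝ)) * |r| ^ k := by
        gcongr
        exact h k
    _ = _ := by rw [mul_pow]; ring

theorem ExpBounded.summable {a : ℕ → ℝ} (ha : ExpBounded a) (x : ℝ) :
    Summable fun k => a k * x ^ k := by
  refine Summable.of_norm_bounded (ha.summable_abs x) fun k => ?_
  rw [Real.norm_eq_abs, abs_mul, abs_pow]

theorem ExpBounded.shift {a : ℕ → ℝ} (ha : ExpBounded a) : ExpBounded fun k => a (k + 1) := by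
  obtain ⟨C, M, hC, hM, h⟩ := ha
  refine ⟨C * M, M, by positivity, hM, fun k => (h (k + 1)).trans ?_⟩
  calc C * (M ^ (k + 1) / ((k + 1).factorial : ℝ)) ≤ C * (M ^ (k + 1) / (k.factorial : ℝ)) := by
        gcongr
        exact Nat.le_succ k
    _ = C * M * (M ^ k / (k.factorial : ℝ)) := by ring

theorem ExpBounded.derivCoeff {a : ℕ → ℝ} (ha : ExpBounded a) : ExpBounded (derivCoeff a) := by
  obtain ⟨C, M, hC, hM, h⟩ := ha
  refine ⟨C * M, M, by positivity, hM, fun k => ?_⟩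
  have hk : (0 : ℝ) < k + 1 := by positivity
  have h' := mul_le_mul_of_nonneg_left (h (k + 1)) hk.le
  rw [_root_.derivCoeff, abs_mul, abs_of_pos hk]
  refine h'.trans_eq ?_
  rw [Nat.factorial_succ]
  push_cast
  field_simp
  ring

theorem ExpBounded.tsum_eq {a : ℕ → ℝ} (ha : ExpBounded a) (x : ℝ) :
    ∑' k, a k * x ^ k = a 0 + x * ∑' k, a (k + 1) * x ^ k := by
  rw [(ha.summable x).tsum_eq_zero_add, ← tsum_mul_left]
  simp only [pow_zero, mul_one, pow_succ]
  congr 1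
  exact tsum_congr fun k => by ring

theorem ExpBounded.hasDerivAt {a : ℕ → ℝ} (ha : ExpBounded a) (x : ℝ) :
    HasDerivAt (fun y => ∑' k, a k * y ^ k) (∑' k, _root_.derivCoeff a k * x ^ k) x := by
  have hR : (0 : ℝ) ≤ |x| + 1 := by positivity
  have hs : Summable fun k : ℕ => |a k| * (k * (|x| + 1) ^ (k - 1)) := by
    rw [← summable_nat_add_iff 1]
    refine (ha.derivCoeff.summable_abs (|x| + 1)).congr fun k => ?_
    have hk : (0 : ℝ) < k + 1 := by positivity
    rw [_root_.derivCoeff, abs_mul, abs_of_pos hk, abs_of_nonneg hR]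
    push_cast
    ring
  have key := hasDerivAt_tsum_of_isPreconnected (t := Metric.ball (0 : ℝ) (|x| + 1))
    (g := fun k y => a k * y ^ k) (g' := fun k y => a k * (k * y ^ (k - 1))) (y₀ := 0) (y := x)
    hs Metric.isOpen_ball (convex_ball _ _).isPreconnected
    (fun k y _ => (hasDerivAt_pow k y).const_mul (a k))
    (fun k y hy => by
      have hy' : |y| ≤ |x| + 1 := by simpa using (mem_ball_zero_iff.1 hy).le
      rw [Real.norm_eq_abs, abs_mul, abs_mul, abs_pow, Nat.abs_cast]
      gcongr)
    (by simp; positivity) (ha.summable 0) (by simp)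
  refine key.congr_deriv ?_
  rw [Summable.tsum_eq_zero_add]
  · simp only [Nat.cast_zero, zero_mul, mul_zero, zero_add, Nat.add_sub_cancel]
    refine tsum_congr fun k => ?_
    rw [_root_.derivCoeff]
    push_cast
    ring
  · refine Summable.of_norm_bounded hs fun k => ?_
    rw [Real.norm_eq_abs, abs_mul, abs_mul, abs_pow, Nat.abs_cast]
    gcongr
    linarith

theorem ExpBounded.analyticOnNhd {a : ℕ → ℝ} (ha : ExpBounded a) :
    AnalyticOnNhd ℝ (fun x => ∑' k, a k * x ^ k) univ := by
  set p := FormalMultilinearSeries.ofScalars ℝ a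
  have hr : p.radius = ⊤ := p.radius_eq_top_of_summable_norm fun r => by
    refine (ha.summable_abs r).congr fun k => ?_
    rw [FormalMultilinearSeries.ofScalars_norm, Real.norm_eq_abs, abs_of_nonneg (NNReal.coe_nonneg r)]
  have h := p.hasFPowerSeriesOnBall (by simp [hr])
  have hsum : p.sum = fun x => ∑' k, a k * x ^ k := by
    funext x
    exact (FormalMultilinearSeries.ofScalars_sum_eq a x).trans (by simp)
  rw [← hsum]
  intro x _
  exact h.analyticAt_of_mem (by simp [hr])

theorem coulombCoeff_one {l : ℝ} (hl : -1/2 < l) (η : ℝ) :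
    (l + 1) * coulombCoeff l η 1 = η := by
  have : l + 1 ≠ 0 := by linarith
  rw [coulombCoeff]
  field_simp

theorem coulombCoeff_add_two {l : ℝ} (hl : -1/2 < l) (η : ℝ) (k : ℕ) :
    ((k : ℝ) + 2) * (k + 2 * l + 3) * coulombCoeff l η (k + 2) =
      2 * η * coulombCoeff l η (k + 1) - coulombCoeff l η k := by
  have h1 : (0 : ℝ) < k + 2 := by positivity
  have h2 : (0 : ℝ) < k + 2 + 2 * l + 1 := by linarith [(Nat.cast_nonneg k : (0 : ℝ) ≤ k)]
  rw [coulombCoeff]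
  field_simp
  ring

theorem expBounded_coulombCoeff {l : ℝ} (hl : -1/2 < l) (η : ℝ) :
    ExpBounded (coulombCoeff l η) := by
  refine ⟨1, 2 * |η| + 1, zero_le_one, by positivity, fun k => ?_⟩
  rw [one_mul]
  set M := 2 * |η| + 1 with hM
  have hη := abs_nonneg η
  have hM1 : 1 ≤ M := by linarith
  induction k using Nat.twoStepInduction with
  | zero => simp [coulombCoeff]
  | one =>
    have h := coulombCoeff_one hl η
    have h' : (l + 1) * |coulombCoeff l η 1| = |η| := by
      rw [← abs_of_pos (by linarith : 0 < l + 1), ← abs_mul, h]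
    have := abs_nonneg (coulombCoeff l η 1)
    simp only [pow_one, Nat.factorial_one, Nat.cast_one, div_one]
    nlinarith
  | more k ih0 ih1 =>
    have h := coulombCoeff_add_two hl η k
    have hk : (0 : ℝ) ≤ k := Nat.cast_nonneg k
    have hp : (0 : ℝ) < ((k : ℝ) + 2) * (k + 2 * l + 3) := by
      apply mul_pos <;> linarith
    have h' : ((k : ℝ) + 2) * (k + 2 * l + 3) * |coulombCoeff l η (k + 2)| ≤
        2 * |η| * |coulombCoeff l η (k + 1)| + |coulombCoeff l η k| := by
      rw [← abs_of_pos hp, ← abs_mul, h]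
      refine (abs_sub _ _).trans ?_
      rw [abs_mul, abs_mul]
      simp
    set F : ℝ := (k.factorial : ℝ) with hF
    have hFp : 0 < F := by positivity
    have f1 : ((k + 1).factorial : ℝ) = (k + 1) * F := by rw [Nat.factorial_succ]; push_cast; rfl
    have f2 : ((k + 2).factorial : ℝ) = (k + 2) * ((k + 1) * F) := by
      rw [Nat.factorial_succ, Nat.cast_mul, f1]; push_cast; ring
    rw [f1] at ih1
    rw [f2]
    have hA : 2 * |η| * |coulombCoeff l η (k + 1)| + |coulombCoeff l η k| ≤
        2 * |η| * (M ^ (k + 1) / ((k + 1) * F)) + M ^ k / F := by gcongr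
    have hB : 2 * |η| * (M ^ (k + 1) / ((k + 1) * F)) + M ^ k / F ≤
        (k + 2) * (k + 2) * (M ^ (k + 2) / ((k + 2) * ((k + 1) * F))) := by
      have e : (k + 2) * (k + 2) * (M ^ (k + 2) / ((k + 2) * ((k + 1) * F))) -
          (2 * |η| * (M ^ (k + 1) / ((k + 1) * F)) + M ^ k / F) =
          M ^ k / ((k + 1) * F) * ((k + 2) * M ^ 2 - 2 * |η| * M - (k + 1)) := by
        field_simp
        ring
      have : 0 ≤ (k + 2) * M ^ 2 - 2 * |η| * M - (k + 1) := by
        have : 1 ≤ M ^ 2 := one_le_pow₀ hM1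
        nlinarith
      have : 0 ≤ M ^ k / ((k + 1) * F) * ((k + 2) * M ^ 2 - 2 * |η| * M - (k + 1)) := by
        positivity
      linarith
    have hC : ((k : ℝ) + 2) * (k + 2) * |coulombCoeff l η (k + 2)| ≤
        (k + 2) * (k + 2) * (M ^ (k + 2) / ((k + 2) * ((k + 1) * F))) := by
      refine le_trans ?_ (h'.trans (hA.trans hB))
      have : (k : ℝ) + 2 ≤ k + 2 * l + 3 := by linarith
      gcongr ?_ * ?_ * _
    exact le_of_mul_le_mul_left hC (by positivity)

/-- Solutions of the differential equation `x y'' + (2 l + 2) y' + (x - 2 η) y = 0`,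
together with their first two derivatives. -/
def IsCoulombSol (l η : ℝ) (f f' f'' : ℝ → ℝ) : Prop :=
  (∀ x, HasDerivAt f (f' x) x) ∧ (∀ x, HasDerivAt f' (f'' x) x) ∧
    ∀ x, x * f'' x + (2 * l + 2) * f' x + (x - 2 * η) * f x = 0

theorem IsCoulombSol.neg {l η : ℝ} {f f' f'' : ℝ → ℝ} (h : IsCoulombSol l η f f' f'') :
    IsCoulombSol l η (fun x => -f x) (fun x => -f' x) (fun x => -f'' x) :=
  ⟨fun x => (h.1 x).neg, fun x => (h.2.1 x).neg, fun x => by linarith [h.2.2 x]⟩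

theorem exists_isCoulombSol_coulombPhi {l : ℝ} (hl : -1/2 < l) (η : ℝ) :
    ∃ f' f'', IsCoulombSol l η (coulombPhi l η) f' f'' := by
  have ha := expBounded_coulombCoeff hl η
  set a := coulombCoeff l η with ha'
  refine ⟨_, _, ha.hasDerivAt, ha.derivCoeff.hasDerivAt, fun x => ?_⟩
  have s1 := (ha.derivCoeff.derivCoeff.summable x).hasSum
  have s2 := (ha.derivCoeff.shift.summable x).hasSum
  have s3 := (ha.summable x).hasSum
  have s4 := (ha.shift.summable x).hasSum
  have s := ((s1.add (s2.mul_left (2 * l + 2))).add s3).sub (s4.mul_left (2 * η))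
  have s0 := s.unique (by
    convert! hasSum_zero (α := ℝ) (β := ℕ) using 2 with k
    have := coulombCoeff_add_two hl η k
    rw [← ha'] at this
    simp only [derivCoeff]
    push_cast
    linear_combination x ^ k * this)
  have e1 := ha.derivCoeff.tsum_eq x
  have e2 := ha.tsum_eq x
  have h0 : derivCoeff a 0 = a 1 := by simp [derivCoeff]
  have h1 : (l + 1) * a 1 = η := coulombCoeff_one hl η
  have h2 : a 0 = 1 := by simp [ha', coulombCoeff]
  rw [h0] at e1
  rw [h2] at e2
  change x * _ + (2 * l + 2) * _ + (x - 2 * η) * (∑' k, a k * x ^ k) = 0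
  linear_combination x * s0 + (2 * l + 2) * e1 - 2 * η * e2 + 2 * h1

theorem coulombCoeff_raise {l : ℝ} (hl : -1/2 < l) (η : ℝ) (k : ℕ) :
    η * coulombCoeff l η (k + 1) - (l + 1) * (k + 2) * coulombCoeff l η (k + 2) =
      (η ^ 2 + (l + 1) ^ 2) / ((l + 1) * (2 * l + 3)) * coulombCoeff (l + 1) η k := by
  have hl1 : l + 1 ≠ 0 := by linarith
  have hl3 : 2 * l + 3 ≠ 0 := by linarith
  have a1 : coulombCoeff l η 1 = η / (l + 1) := by rw [coulombCoeff]
  have b1 : coulombCoeff (l + 1) η 1 = η / (l + 2) := by rw [coulombCoeff]; ring_nf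
  have a2 := coulombCoeff_add_two hl η
  have b2 := coulombCoeff_add_two (by linarith : -1/2 < l + 1) η
  have a0 : coulombCoeff l η 0 = 1 := by rw [coulombCoeff]
  have b0 : coulombCoeff (l + 1) η 0 = 1 := by rw [coulombCoeff]
  generalize hC : (η ^ 2 + (l + 1) ^ 2) / ((l + 1) * (2 * l + 3)) = C
  have h0 : η * coulombCoeff l η 1 - (l + 1) * 2 * coulombCoeff l η 2 = C := by
    have e := a2 0
    have hC' : (l + 1) * (2 * l + 3) * C = η ^ 2 + (l + 1) ^ 2 := by
      rw [← hC, mul_div_cancel₀ _ (mul_ne_zero hl1 hl3)]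
    have hη := coulombCoeff_one hl η
    apply mul_left_cancel₀ (mul_ne_zero hl1 hl3)
    rw [zero_add, a0] at e
    push_cast at e
    linear_combination (2 * l + 3) * η * hη - (l + 1) ^ 2 * e - 2 * (l + 1) * η * hη - hC'
  generalize coulombCoeff l η = a at *
  generalize coulombCoeff (l + 1) η = b at *
  induction k using Nat.twoStepInduction with
  | zero => simpa [b0] using h0
  | one =>
    have e2 := a2 0
    have e3 := a2 1
    have hl2 : l + 2 ≠ 0 := by linarith
    have hη : η = (l + 1) * a 1 := by rw [a1]; field_simp
    have hb : (l + 2) * b 1 = η := by rw [b1]; field_simp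
    have h2l : 2 * l + 4 ≠ 0 := by intro h; apply hl2; linarith
    rw [a0] at e2
    norm_num at e2 e3 h0 ⊢
    apply mul_left_cancel₀ h2l
    linear_combination -(l + 1) * e3 + η * e2 - 2 * C * hb + 2 * η * h0 - hη
  | more k ih0 ih1 =>
    have e1 := a2 (k + 1)
    have e2 := a2 (k + 2)
    have e3 := b2 k
    have hk : ((k : ℝ) + 2) * (k + 2 * (l + 1) + 3) ≠ 0 := by
      have : (0 : ℝ) ≤ k := Nat.cast_nonneg k
      apply ne_of_gt
      apply mul_pos <;> linarith
    apply mul_left_cancel₀ hk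
    push_cast at *
    linear_combination -(l + 1) * (k + 2) * e2 + η * e1 - C * e3 + 2 * η * ih1 - ih0

theorem coulombPhi_raise {l : ℝ} (hl : -1/2 < l) (η : ℝ) :
    ∃ C, 0 < C ∧ ∀ x, HasDerivAt (coulombPhi l η)
      ((η * coulombPhi l η x - C * x * coulombPhi (l + 1) η x) / (l + 1)) x := by
  have hl1 : 0 < l + 1 := by linarith
  have hl3 : 0 < 2 * l + 3 := by linarith
  refine ⟨(η ^ 2 + (l + 1) ^ 2) / ((l + 1) * (2 * l + 3)), by positivity, fun x => ?_⟩
  have ha := expBounded_coulombCoeff hl η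
  have hb := expBounded_coulombCoeff (by linarith : -1/2 < l + 1) η
  convert! ha.hasDerivAt x using 1
  rw [div_eq_iff hl1.ne']
  have e1 := ha.derivCoeff.tsum_eq x
  have e2 := ha.tsum_eq x
  have s1 := (ha.derivCoeff.shift.summable x).hasSum
  have s2 := (ha.shift.summable x).hasSum
  have s3 := (hb.summable x).hasSum
  have s := ((s1.mul_left (l + 1)).sub (s2.mul_left η)).add
    (s3.mul_left ((η ^ 2 + (l + 1) ^ 2) / ((l + 1) * (2 * l + 3))))
  have s0 := s.unique (by
    convert! hasSum_zero (α := ℝ) (β := ℕ) using 2 with k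
    have := coulombCoeff_raise hl η k
    simp only [derivCoeff]
    push_cast
    linear_combination -x ^ k * this)
  have h0 : derivCoeff (coulombCoeff l η) 0 = coulombCoeff l η 1 := by simp [derivCoeff]
  have h2 : coulombCoeff l η 0 = 1 := by rw [coulombCoeff]
  rw [h0] at e1
  rw [h2] at e2
  simp only [coulombPhi]
  linear_combination η * e2 - (l + 1) * e1 - coulombCoeff_one hl η - x * s0

theorem forall_pos_or_forall_neg_of_ne_zero {f : ℝ → ℝ} (hf : Continuous f) {a b : ℝ}
    (h : ∀ x ∈ Ioo a b, f x ≠ 0) : (∀ x ∈ Ioo a b, 0 < f x) ∨ ∀ x ∈ Ioo a b, 0 < -f x := by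
  by_contra! hc
  obtain ⟨⟨x, hx, hfx⟩, y, hy, hfy⟩ := hc
  obtain ⟨z, hz, hz0⟩ := isPreconnected_Ioo.intermediate_value hx hy hf.continuousOn
    (⟨hfx, by linarith⟩ : (0 : ℝ) ∈ Icc (f x) (f y))
  exact h z hz hz0

theorem HasDerivAt.nonneg_of_eq_zero_of_pos_right {f : ℝ → ℝ} {f' a b : ℝ} (hab : a < b)
    (hf : HasDerivAt f f' a) (h0 : f a = 0) (h : ∀ x ∈ Ioo a b, 0 < f x) : 0 ≤ f' := by
  have ht := (hasDerivWithinAt_iff_tendsto_slope' (s := Ioi a) (by simp)).1 hf.hasDerivWithinAt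
  refine ge_of_tendsto ht ?_
  filter_upwards [Ioo_mem_nhdsGT hab] with x hx
  rw [slope_def_field, h0, sub_zero]
  exact div_nonneg (h x hx).le (sub_nonneg.2 hx.1.le)

theorem HasDerivAt.nonpos_of_eq_zero_of_pos_left {f : ℝ → ℝ} {f' a b : ℝ} (hab : a < b)
    (hf : HasDerivAt f f' b) (h0 : f b = 0) (h : ∀ x ∈ Ioo a b, 0 < f x) : f' ≤ 0 := by
  have ht := (hasDerivWithinAt_iff_tendsto_slope' (s := Iio b) (by simp)).1 hf.hasDerivWithinAt
  refine le_of_tendsto ht ?_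
  filter_upwards [Ioo_mem_nhdsLT hab] with x hx
  rw [slope_def_field, h0, sub_zero]
  exact div_nonpos_of_nonneg_of_nonpos (h x hx).le (sub_nonpos.2 hx.2.le)

theorem nonneg_on_Icc_of_pos_on_Ioo {f : ℝ → ℝ} (hf : Continuous f) {a b : ℝ} (hab : a < b)
    (h : ∀ x ∈ Ioo a b, 0 < f x) : ∀ x ∈ Icc a b, 0 ≤ f x := by
  intro x hx
  rw [← closure_Ioo hab.ne] at hx
  exact le_on_closure (fun y hy => (h y hy).le) continuousOn_const hf.continuousOn hx

/-- Sturm comparison: both solutions cannot stay positive between zeros of the one with the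
larger parameter. -/
theorem IsCoulombSol.not_both_pos {l L η : ℝ} (hl : -1/2 < l) (hL : l < L)
    {f f' f'' g g' g'' : ℝ → ℝ} (hf : IsCoulombSol L η f f' f'') (hg : IsCoulombSol l η g g' g'')
    {a b : ℝ} (ha : 0 ≤ a) (hab : a < b) (ha0 : a = 0 ∨ f a = 0) (hb0 : f b = 0)
    (hfp : ∀ x ∈ Ioo a b, 0 < f x) (hgp : ∀ x ∈ Ioo a b, 0 < g x) : False := by
  set p := l + L + 1 with hp
  have hp0 : 0 < p := by linarith
  have hfc : Continuous f := continuous_iff_continuousAt.2 fun x => (hf.1 x).continuousAt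
  have hgc : Continuous g := continuous_iff_continuousAt.2 fun x => (hg.1 x).continuousAt
  have hfc' : Continuous f' := continuous_iff_continuousAt.2 fun x => (hf.2.1 x).continuousAt
  have hgc' : Continuous g' := continuous_iff_continuousAt.2 fun x => (hg.2.1 x).continuousAt
  have hg0 := nonneg_on_Icc_of_pos_on_Ioo hgc hab hgp
  let W : ℝ → ℝ := fun x => x ^ p * ((L - l) * (f x * g x) + x * (f' x * g x - f x * g' x))
  have hWc : Continuous W := by
    have : Continuous fun x : ℝ => x ^ p := Real.continuous_rpow_const hp0.le
    fun_prop
  have hWd : ∀ x, 0 < x → HasDerivAt W ((L - l) * p * x ^ (p - 1) * (f x * g x)) x := by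
    intro x hx
    have hd := (Real.hasDerivAt_rpow_const (p := p) (Or.inl hx.ne')).mul
      ((((hf.1 x).mul (hg.1 x)).const_mul (L - l)).add
        ((hasDerivAt_id x).mul (((hf.2.1 x).mul (hg.1 x)).sub ((hf.1 x).mul (hg.2.1 x)))))
    refine hd.congr_deriv ?_
    have hxp : x ^ p = x ^ (p - 1) * x := by
      rw [← Real.rpow_add_one hx.ne']; ring_nf
    simp only [Pi.add_apply, Pi.mul_apply, Pi.sub_apply, id]
    rw [hxp, hp]
    linear_combination x ^ (l + L + 1 - 1) * x * g x * hf.2.2 x -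
      x ^ (l + L + 1 - 1) * x * f x * hg.2.2 x
  have hmono : StrictMonoOn W (Icc a b) := by
    refine strictMonoOn_of_deriv_pos (convex_Icc a b) hWc.continuousOn fun x hx => ?_
    rw [interior_Icc] at hx
    have hx0 : 0 < x := ha.trans_lt hx.1
    rw [(hWd x hx0).deriv]
    have := hfp x hx
    have := hgp x hx
    have := Real.rpow_pos_of_pos hx0 (p - 1)
    have := sub_pos.2 hL
    positivity
  have hlt := hmono (left_mem_Icc.2 hab.le) (right_mem_Icc.2 hab.le) hab
  have hWa : 0 ≤ W a := by
    rcases ha0 with h | h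
    · simp [W, h, Real.zero_rpow hp0.ne']
    · have h1 := (hf.1 a).nonneg_of_eq_zero_of_pos_right hab h hfp
      have h2 := hg0 a (left_mem_Icc.2 hab.le)
      simp only [W, h]
      have := Real.rpow_nonneg ha p
      simp only [zero_mul, mul_zero, zero_add, sub_zero]
      positivity
  have hWb : W b ≤ 0 := by
    have h1 := (hf.1 b).nonpos_of_eq_zero_of_pos_left hab hb0 hfp
    have h2 := hg0 b (right_mem_Icc.2 hab.le)
    have hb : 0 ≤ b := ha.trans hab.le
    have := Real.rpow_nonneg hb p
    simp only [W, hb0, zero_mul, mul_zero, zero_add, sub_zero]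
    exact mul_nonpos_of_nonneg_of_nonpos this
      (mul_nonpos_of_nonneg_of_nonpos hb (mul_nonpos_of_nonpos_of_nonneg h1 h2))
  linarith

theorem coulombPhi_zero (l η : ℝ) : coulombPhi l η 0 = 1 := by
  rw [coulombPhi, tsum_eq_single 0 fun k hk => by simp [hk]]
  simp [coulombCoeff]

theorem eventually_coulombPhi_ne_zero {l : ℝ} (hl : -1/2 < l) (η a : ℝ) :
    ∀ᶠ x in 𝓝[≠] a, coulombPhi l η x ≠ 0 := by
  have h := (expBounded_coulombCoeff hl η).analyticOnNhd
  refine (h a (mem_univ a)).eventually_eq_zero_or_eventually_ne_zero.resolve_left fun h0 => ?_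
  have := h.eq_of_eventuallyEq (g := fun _ => 0) (fun _ _ => analyticAt_const) h0
  have h1 := coulombPhi_zero l η
  exact one_ne_zero (h1.symm.trans (congrFun this 0))

theorem exists_first_zero {f : ℝ → ℝ} (hf : Continuous f) {a b : ℝ} (hab : a < b)
    (ha : ∀ᶠ x in 𝓝[≠] a, f x ≠ 0) (hb : f b = 0) :
    ∃ c, a < c ∧ c ≤ b ∧ f c = 0 ∧ ∀ x ∈ Ioo a c, f x ≠ 0 := by
  have ha' : ∀ᶠ x in 𝓝[>] a, f x ≠ 0 := ha.filter_mono (nhdsWithin_mono _ fun x hx => ne_of_gt hx)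
  obtain ⟨e, hae, he⟩ := mem_nhdsGT_iff_exists_Ioo_subset.1 ha'
  have heb : e ≤ b := not_lt.1 fun h => he ⟨hab, h⟩ hb
  obtain ⟨c, ⟨⟨hec, hcb⟩, hc0⟩, hmin⟩ :=
    (isCompact_Icc.inter_right (isClosed_singleton.preimage hf) :
      IsCompact (Icc e b ∩ f ⁻¹' {0})).exists_isLeast ⟨b, ⟨heb, le_rfl⟩, hb⟩
  refine ⟨c, lt_of_lt_of_le hae hec, hcb, hc0, fun x hx hx0 => ?_⟩
  rcases lt_or_ge x e with h | h
  · exact he ⟨hx.1, h⟩ hx0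
  · exact (hmin ⟨⟨h, hx.2.le.trans hcb⟩, hx0⟩).not_gt hx.2

/-- Between two zeros of `coulombPhi L η` (or between the origin and a positive zero) there is a
zero of `coulombPhi l η` when `l < L`. -/
theorem exists_coulombPhi_eq_zero_of_lt {l L : ℝ} (hl : -1/2 < l) (hL : l < L) (η : ℝ) {a b : ℝ}
    (ha : 0 ≤ a) (hab : a < b) (ha0 : a = 0 ∨ coulombPhi L η a = 0) (hb0 : coulombPhi L η b = 0) :
    ∃ c ∈ Ioo a b, coulombPhi l η c = 0 := by
  by_contra! hc
  have hL' : -1/2 < L := hl.trans hL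
  obtain ⟨f', f'', hf⟩ := exists_isCoulombSol_coulombPhi hL' η
  obtain ⟨g', g'', hg⟩ := exists_isCoulombSol_coulombPhi hl η
  have hfc : Continuous (coulombPhi L η) :=
    continuous_iff_continuousAt.2 fun x => (hf.1 x).continuousAt
  have hgc : Continuous (coulombPhi l η) :=
    continuous_iff_continuousAt.2 fun x => (hg.1 x).continuousAt
  obtain ⟨d, had, hdb, hd0, hne⟩ :=
    exists_first_zero hfc hab (eventually_coulombPhi_ne_zero hL' η a) hb0
  have hgne : ∀ x ∈ Ioo a d, coulombPhi l η x ≠ 0 := fun x hx => hc x ⟨hx.1, hx.2.trans_le hdb⟩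
  rcases forall_pos_or_forall_neg_of_ne_zero hfc hne with h1 | h1 <;>
    rcases forall_pos_or_forall_neg_of_ne_zero hgc hgne with h2 | h2
  · exact hf.not_both_pos hl hL hg ha had ha0 hd0 h1 h2
  · exact hf.not_both_pos hl hL hg.neg ha had ha0 hd0 h1 h2
  · exact hf.neg.not_both_pos hl hL hg ha had (by simpa using ha0) (by simpa using hd0) h1 h2
  · exact hf.neg.not_both_pos hl hL hg.neg ha had (by simpa using ha0) (by simpa using hd0) h1 h2

/-- Between two positive zeros of `coulombPhi l η` there is a zero of `coulombPhi (l + 1) η`. -/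
theorem exists_coulombPhi_add_one_eq_zero {l : ℝ} (hl : -1/2 < l) (η : ℝ) {a b : ℝ}
    (ha : 0 < a) (hab : a < b) (ha0 : coulombPhi l η a = 0) (hb0 : coulombPhi l η b = 0) :
    ∃ c ∈ Ioo a b, coulombPhi (l + 1) η c = 0 := by
  have hl1 : l + 1 ≠ 0 := by linarith
  obtain ⟨C, hC, hd⟩ := coulombPhi_raise hl η
  have hG : ∀ x, HasDerivAt (fun y => coulombPhi l η y * Real.exp (-(η / (l + 1)) * y))
      (-(C / (l + 1)) * x * coulombPhi (l + 1) η x * Real.exp (-(η / (l + 1)) * x)) x := by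
    intro x
    refine ((hd x).mul ((hasDerivAt_id x).const_mul (-(η / (l + 1)))).exp).congr_deriv ?_
    simp only [id]
    field_simp
    ring
  obtain ⟨c, hc, h⟩ := exists_hasDerivAt_eq_zero hab
    (fun x _ => (hG x).continuousAt.continuousWithinAt) (by simp [ha0, hb0]) (fun x _ => hG x)
  refine ⟨c, hc, ?_⟩
  have hc0 : c ≠ 0 := (ha.trans hc.1).ne'
  simpa [hC.ne', hl1, hc0, Real.exp_ne_zero] using h

theorem IsPosZeroEnum.le_of_strictMono {f : ℝ → ℝ} {ρ c : ℕ → ℝ} (hρ : IsPosZeroEnum f ρ)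
    (hc : StrictMono c) (h : ∀ k, 0 < c k ∧ f (c k) = 0) (k : ℕ) : ρ k ≤ c k := by
  choose j hj using fun k => hρ.2.2 (c k) (h k).1 (h k).2
  have hjm : StrictMono j := fun m n hmn => hρ.1.lt_iff_lt.1 (by rw [hj, hj]; exact hc hmn)
  rw [← hj k]
  exact hρ.1.monotone hjm.le_apply

theorem exists_strictMono_zeros_of_lt {l L : ℝ} (hl : -1/2 < l) (hL : l < L) (η : ℝ) {c : ℕ → ℝ}
    (hc : StrictMono c) (h : ∀ k, 0 < c k ∧ coulombPhi L η (c k) = 0) :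
    ∃ d : ℕ → ℝ, StrictMono d ∧ (∀ k, 0 < d k ∧ coulombPhi l η (d k) = 0) ∧ ∀ k, d k < c k := by
  obtain ⟨d₀, hd₀, hz₀⟩ :=
    exists_coulombPhi_eq_zero_of_lt hl hL η le_rfl (h 0).1 (Or.inl rfl) (h 0).2
  choose d hd hz using fun k => exists_coulombPhi_eq_zero_of_lt hl hL η (h k).1.le
    (hc (Nat.lt_succ_self k)) (Or.inr (h k).2) (h (k + 1)).2
  let e : ℕ → ℝ := fun k => Nat.casesOn k d₀ d
  have hlt : ∀ k, e k < c k := by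
    rintro (_ | k)
    exacts [hd₀.2, (hd k).2]
  refine ⟨e, strictMono_nat_of_lt_succ fun k => (hlt k).trans (hd k).1, ?_, hlt⟩
  rintro (_ | k)
  exacts [⟨hd₀.1, hz₀⟩, ⟨(h k).1.trans (hd k).1, hz k⟩]

/-- Corollary of Theorems 3.1 and 4.1: for −1/2 < ℓ < L with L − ℓ ≤ 1, the positive zeros
of φ_{ℓ,η} and φ_{L,η} interlace as 0 < ρ_{ℓ,η,1} < ρ_{L,η,1} < ρ_{ℓ,η,2} < ρ_{L,η,2} < ⋯ . -/
theorem stmt_9 (η l L : ℝ) (h₁ : -1/2 < l) (h₂ : l < L) (h₃ : L - l ≤ 1) :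
    ∀ ρ₁ ρ₂ : ℕ → ℝ, IsPosZeroEnum (coulombPhi l η) ρ₁ →
      IsPosZeroEnum (coulombPhi L η) ρ₂ →
        ∀ k, ρ₁ k < ρ₂ k ∧ ρ₂ k < ρ₁ (k + 1) := by
  intro ρ₁ ρ₂ hρ₁ hρ₂ k
  constructor
  · obtain ⟨d, hd, hz, hlt⟩ := exists_strictMono_zeros_of_lt h₁ h₂ η hρ₂.1 hρ₂.2.1
    exact (hρ₁.le_of_strictMono hd hz k).trans_lt (hlt k)
  · choose c hc hz using fun k => exists_coulombPhi_add_one_eq_zero h₁ η (hρ₁.2.1 k).1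
      (hρ₁.1 (Nat.lt_succ_self k)) (hρ₁.2.1 k).2 (hρ₁.2.1 (k + 1)).2
    have hcm : StrictMono c := strictMono_nat_of_lt_succ fun k => (hc k).2.trans (hc (k + 1)).1
    have hcz : ∀ k, 0 < c k ∧ coulombPhi (l + 1) η (c k) = 0 :=
      fun k => ⟨(hρ₁.2.1 k).1.trans (hc k).1, hz k⟩
    refine lt_of_le_of_lt ?_ (hc k).2
    rcases (by linarith : L ≤ l + 1).eq_or_lt with hL | hL
    · rw [← hL] at hcz
      exact hρ₂.le_of_strictMono hcm hcz k
    · obtain ⟨d, hd, hdz, hlt⟩ := exists_strictMono_zeros_of_lt (h₁.trans h₂) hL η hcm hcz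
      exact (hρ₂.le_of_strictMono hd hdz k).trans (hlt k).le
end
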